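/- Let 1<p,q<∞, 1/r := 1/q − 1/p, α/d := 1/p − 1/q. Let μ, λ be weights with μ' := μ^{−p'/p}, ν^{1/p+1/q'} = μ^{1/p} λ^{−1/q}, and assume [μ',λ,ν]_{B_{p',q}} := sup_Q ⟨μ'⟩_Q^{1/p'} ⟨λ⟩_Q^{1/q} ⟨ν⟩_Q^{1/p+1/q'} < ∞. Let 𝒟 be a dyadic lattice, γ ∈ (0,1), and 𝒮 ⊆ 𝒟 a γ-sparse family. Then for every b ∈ L^1_loc the operator f ↦ Σ_{Q∈𝒮} ⟨|b − ⟨b⟩_Q|⟩_Q ⟨|f|⟩_Q 1_Q is bounded from L^p(μ) to L^q(λ) with norm ≲ [μ',λ,ν]_{B_{p',q}} [μ']_{A_∞}^{1/p} [λ]_{A_∞}^{1/q'} · ‖b‖_{BMO_ν^α} when p ≤ q, and with norm ≲ [μ',λ,ν]_{B_{p',q}} [μ']_{A_∞}^{1/p} [λ]_{A_∞}^{1/q'} [ν]_{A_∞}^{1/r} · ‖M_ν^# b‖_{L^r(ν)} when p > q. -/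

import Mathlib

open MeasureTheory ENNReal Set Filter

noncomputable section

/-- `ℝ^d` with the Euclidean structure. -/
abbrev Rd (d : ℕ) := EuclideanSpace ℝ (Fin d)

variable {d : ℕ}

/-- An axis-parallel cube in `ℝ^d`, given by a corner and a (positive) side length. -/
structure Cube (d : ℕ) where
  corner : Fin d → ℝ
  side : ℝ
  side_pos : 0 < side

namespace Cube

/-- The set of points of the cube. -/
def carrier (Q : Cube d) : Set (Rd d) :=
  {x | ∀ i, Q.corner i ≤ x i ∧ x i < Q.corner i + Q.side}

/-- The volume `|Q| = ℓ(Q)^d` of the cube. -/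
def vol (Q : Cube d) : ℝ := Q.side ^ d

/-- The concentric cube with twice the side length. -/
def double (Q : Cube d) : Cube d :=
  ⟨fun i => Q.corner i - Q.side / 2, 2 * Q.side, by have := Q.side_pos; linarith⟩

end Cube

/-- `∫_Q f`. -/
def intC (Q : Cube d) (f : Rd d → ℝ) : ℝ := ∫ x in Q.carrier, f x

/-- `w(Q) = ∫_Q w`. -/
def wInt (Q : Cube d) (w : Rd d → ℝ) : ℝ := intC Q w

/-- The average `⟨f⟩_Q = |Q|⁻¹ ∫_Q f`. -/
def avg (Q : Cube d) (f : Rd d → ℝ) : ℝ := Q.vol⁻¹ * intC Q f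

/-- The mean oscillation `∫_Q |f - ⟨f⟩_Q|`. -/
def osc (Q : Cube d) (b : Rd d → ℝ) : ℝ := ∫ x in Q.carrier, |b x - avg Q b|

/-- The conjugate (dual) exponent `p' = p/(p-1)`. -/
def conj (p : ℝ) : ℝ := p / (p - 1)

/-- The weighted Lebesgue norm `‖f‖_{L^p(w)} = (∫ |f|^p w dx)^{1/p}`. -/
def wnorm (p : ℝ) (w : Rd d → ℝ) (f : Rd d → ℝ) : ℝ≥0∞ :=
  (∫⁻ x, ENNReal.ofReal (|f x| ^ p * w x)) ^ (1 / p)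

/-- The weighted Lebesgue norm of an `ℝ≥0∞`-valued function. -/
def wnormE (p : ℝ) (w : Rd d → ℝ) (f : Rd d → ℝ≥0∞) : ℝ≥0∞ :=
  (∫⁻ x, f x ^ p * ENNReal.ofReal (w x)) ^ (1 / p)

/-- A weight: a positive, measurable, locally integrable function. -/
def IsWeight (w : Rd d → ℝ) : Prop :=
  (∀ x, 0 < w x) ∧ Measurable w ∧ LocallyIntegrable w volume

/-- `b ∈ L¹_loc`. -/
def L1loc (b : Rd d → ℝ) : Prop := Measurable b ∧ LocallyIntegrable b volume

/-- Bounded measurable functions with compact support (the class `L^∞_c`). -/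
def BddCompactSupp (f : Rd d → ℝ) : Prop :=
  Measurable f ∧ HasCompactSupport f ∧ ∃ M : ℝ, ∀ x, |f x| ≤ M

/-- `‖U‖_{L^p(μ) → L^q(λ)} ≤ N`, tested on all measurable functions. -/
def OpBound (p q : ℝ) (μ lam : Rd d → ℝ) (U : (Rd d → ℝ) → Rd d → ℝ) (N : ℝ) : Prop :=
  ∀ f : Rd d → ℝ, Measurable f → wnorm q lam (U f) ≤ ENNReal.ofReal N * wnorm p μ f

/-- `‖U‖_{L^p(μ) → L^q(λ)} ≤ N`, tested on the dense class `L^∞_c`. -/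
def OpBoundCS (p q : ℝ) (μ lam : Rd d → ℝ) (U : (Rd d → ℝ) → Rd d → ℝ) (N : ℝ) : Prop :=
  ∀ f : Rd d → ℝ, BddCompactSupp f → wnorm q lam (U f) ≤ ENNReal.ofReal N * wnorm p μ f

/-- The weighted sharp maximal function, with cubes restricted to the family `𝒟`. -/
def sharpMaxOn (𝒟 : Set (Cube d)) (ν b : Rd d → ℝ) (x : Rd d) : ℝ≥0∞ :=
  ⨆ (Q : Cube d) (_ : Q ∈ 𝒟) (_ : x ∈ Q.carrier), ENNReal.ofReal (osc Q b / wInt Q ν)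

/-- `‖M^♯_ν b‖_{L^r(ν)}`. -/
def sharpNormOn (𝒟 : Set (Cube d)) (r : ℝ) (ν b : Rd d → ℝ) : ℝ≥0∞ :=
  wnormE r ν (sharpMaxOn 𝒟 ν b)

/-- `‖b‖_{BMO_ν^α} = sup_Q ν(Q)^{-e} ∫_Q |b - ⟨b⟩_Q|` with `e = 1 + α/d`. -/
def bmoNormOn (𝒟 : Set (Cube d)) (e : ℝ) (ν b : Rd d → ℝ) : ℝ≥0∞ :=
  ⨆ (Q : Cube d) (_ : Q ∈ 𝒟), ENNReal.ofReal (osc Q b / wInt Q ν ^ e)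

/-- The Muckenhoupt `A_p` characteristic over the family `𝒟`. -/
def ApCharOn (𝒟 : Set (Cube d)) (p : ℝ) (w : Rd d → ℝ) : ℝ≥0∞ :=
  ⨆ (Q : Cube d) (_ : Q ∈ 𝒟),
    ENNReal.ofReal (avg Q w * avg Q (fun x => w x ^ (-(conj p / p))) ^ (p / conj p))

/-- `w ∈ A_p` (over the family `𝒟`). -/
def IsApOn (𝒟 : Set (Cube d)) (p : ℝ) (w : Rd d → ℝ) : Prop :=
  IsWeight w ∧ LocallyIntegrable (fun x => w x ^ (-(conj p / p))) volume ∧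
    ApCharOn 𝒟 p w < ⊤

/-- The Fujii–Wilson `A_∞` characteristic over the family `𝒟`. -/
def AinfCharOn (𝒟 : Set (Cube d)) (w : Rd d → ℝ) : ℝ≥0∞ :=
  ⨆ (Q : Cube d) (_ : Q ∈ 𝒟),
    (∫⁻ x in Q.carrier,
        ⨆ (R : Cube d) (_ : R ∈ 𝒟) (_ : x ∈ R.carrier),
          ENNReal.ofReal ((∫ y in Q.carrier ∩ R.carrier, w y) / R.vol)) /
      ENNReal.ofReal (wInt Q w)

/-- The relative Fujii–Wilson characteristic `[w]_{A_∞(ν)}` over the family `𝒟`. -/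
def relAinfOn (𝒟 : Set (Cube d)) (w ν : Rd d → ℝ) : ℝ≥0∞ :=
  ⨆ (Q : Cube d) (_ : Q ∈ 𝒟),
    (∫⁻ x in Q.carrier,
        (⨆ (R : Cube d) (_ : R ∈ 𝒟) (_ : R.carrier ⊆ Q.carrier) (_ : x ∈ R.carrier),
          ENNReal.ofReal (wInt R w / wInt R ν)) * ENNReal.ofReal (ν x)) /
      ENNReal.ofReal (wInt Q w)

/-- The joint Bloom–Muckenhoupt characteristic `[μ',λ,ν]_{B_{p',q}}` (for upper bounds). -/
def BupperOn (𝒟 : Set (Cube d)) (p q : ℝ) (μ' lam ν : Rd d → ℝ) : ℝ≥0∞ :=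
  ⨆ (Q : Cube d) (_ : Q ∈ 𝒟),
    ENNReal.ofReal (avg Q μ' ^ (1 / conj p) * avg Q lam ^ (1 / q) *
      avg Q ν ^ (1 / p + 1 / conj q))

/-- The joint Bloom–Muckenhoupt characteristic `[μ,λ']_{B_{p,q'}(ν)}` (for lower bounds). -/
def BlowerOn (𝒟 : Set (Cube d)) (p q : ℝ) (μ lam' ν : Rd d → ℝ) : ℝ≥0∞ :=
  ⨆ (Q : Cube d) (_ : Q ∈ 𝒟),
    ENNReal.ofReal ((wInt Q μ / wInt Q ν) ^ (1 / p) * (wInt Q lam' / wInt Q ν) ^ (1 / conj q))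

/-- A doubling weight. -/
def DoublingWeight (w : Rd d → ℝ) : Prop :=
  ∃ C : ℝ, 0 < C ∧ ∀ Q : Cube d, wInt Q.double w ≤ C * wInt Q w

/-- A `(γ, ν)`-sparse collection of cubes (with respect to a weight `ν`). -/
def SparseFamily (γ : ℝ) (ν : Rd d → ℝ) (S : Set (Cube d)) : Prop :=
  ∃ E : Cube d → Set (Rd d),
    (∀ Q ∈ S, E Q ⊆ Q.carrier ∧ MeasurableSet (E Q) ∧ γ * wInt Q ν ≤ ∫ x in E Q, ν x) ∧
    S.Pairwise fun Q R => Disjoint (E Q) (E R)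

/-- A `(γ, ν)`-sparse collection of cubes (with respect to a measure `ν`). -/
def MSparseFamily (γ : ℝ) (ν : Measure (Rd d)) (S : Set (Cube d)) : Prop :=
  ∃ E : Cube d → Set (Rd d),
    (∀ Q ∈ S, E Q ⊆ Q.carrier ∧ ENNReal.ofReal γ * ν Q.carrier ≤ ν (E Q)) ∧
    S.Pairwise fun Q R => Disjoint (E Q) (E R)

/-- The weighted sharp maximal function with respect to a measure `ν`. -/
def mSharpMaxOn (𝒟 : Set (Cube d)) (ν : Measure (Rd d)) (b : Rd d → ℝ) (x : Rd d) : ℝ≥0∞ :=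
  ⨆ (Q : Cube d) (_ : Q ∈ 𝒟) (_ : x ∈ Q.carrier), ENNReal.ofReal (osc Q b) / ν Q.carrier

/-- The distance between two sets in `ℝ^d`. -/
def setDist (s t : Set (Rd d)) : ℝ := sInf {r | ∃ x ∈ s, ∃ y ∈ t, r = dist x y}

/-- Supports separated by a positive distance. -/
def SeparatedSupports (f g : Rd d → ℝ) : Prop :=
  ∃ ε : ℝ, 0 < ε ∧ ∀ x ∈ tsupport f, ∀ y ∈ tsupport g, ε ≤ dist x y

/-- A dyadic lattice on `ℝ^d`: for every `k ∈ ℤ` a partition of `ℝ^d` into cubes of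
side length `2^{-k}`, each refining the previous one. -/
structure DyadicLattice (d : ℕ) where
  layer : ℤ → Set (Cube d)
  side_eq : ∀ k : ℤ, ∀ Q ∈ layer k, Q.side = (2 : ℝ) ^ (-k)
  covers : ∀ k : ℤ, ∀ x : Rd d, ∃ Q ∈ layer k, x ∈ Q.carrier
  pairwiseDisjoint : ∀ k : ℤ, ∀ Q ∈ layer k, ∀ R ∈ layer k,
    Q ≠ R → Q.carrier ∩ R.carrier = ∅
  refines : ∀ k : ℤ, ∀ Q ∈ layer (k + 1), ∃ R ∈ layer k, Q.carrier ⊆ R.carrier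

/-- The cubes of a dyadic lattice. -/
def DyadicLattice.cubes (D : DyadicLattice d) : Set (Cube d) := {Q | ∃ k, Q ∈ D.layer k}

/-- `𝒟(Q₀)`: the dyadic cubes contained in `Q₀`. -/
def DyadicLattice.below (D : DyadicLattice d) (Q₀ : Cube d) : Set (Cube d) :=
  {Q ∈ D.cubes | Q.carrier ⊆ Q₀.carrier}

open Classical in
/-- The martingale difference `D_Q b = Σ_{R : R̂ = Q} ⟨b⟩_R 1_R − ⟨b⟩_Q 1_Q`. -/
def DyadicLattice.DQ (D : DyadicLattice d) (Q : Cube d) (b : Rd d → ℝ) (x : Rd d) : ℝ :=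
  if h : x ∈ Q.carrier ∧
      ∃ R, R ∈ D.cubes ∧ R.side = Q.side / 2 ∧ x ∈ R.carrier ∧ R.carrier ⊆ Q.carrier
  then avg h.2.choose b - avg Q b
  else 0

/-- Finite partial sums `Σ_{Q ∈ F} D_Q b ⟨f⟩_Q` of the paraproduct. -/
def parasum (D : DyadicLattice d) (b f : Rd d → ℝ) (F : Finset (Cube d)) (x : Rd d) : ℝ :=
  ∑ Q ∈ F, D.DQ Q b x * avg Q f

/-- Unconditional convergence of the paraproduct sum in `L¹_loc` to the function `S`. -/
def UncondConvL1loc (D : DyadicLattice d) (b f S : Rd d → ℝ) : Prop :=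
  ∀ K : Set (Rd d), IsCompact K → ∀ ε : ℝ, 0 < ε →
    ∃ F₀ : Finset (Cube d), ↑F₀ ⊆ D.cubes ∧
      ∀ F : Finset (Cube d), ↑F ⊆ D.cubes → F₀ ⊆ F →
        ∫ x in K, |parasum D b f F x - S x| < ε

/-- `P` is the dyadic paraproduct `Π_b` associated to `b` and the lattice `D`. -/
def IsParaproduct (D : DyadicLattice d) (b : Rd d → ℝ) (P : (Rd d → ℝ) → Rd d → ℝ) : Prop :=
  ∀ f : Rd d → ℝ, BddCompactSupp f → UncondConvL1loc D b f (P f)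

/-- Unconditional convergence of the paraproduct sum in `L^q(λ)` to the function `S`. -/
def UncondConvLq (D : DyadicLattice d) (q : ℝ) (lam : Rd d → ℝ) (b f S : Rd d → ℝ) : Prop :=
  ∀ ε : ℝ, 0 < ε →
    ∃ F₀ : Finset (Cube d), ↑F₀ ⊆ D.cubes ∧
      ∀ F : Finset (Cube d), ↑F ⊆ D.cubes → F₀ ⊆ F →
        wnorm q lam (fun x => parasum D b f F x - S x) < ENNReal.ofReal ε

/-- A modulus of continuity: increasing with `ω(t) → 0` as `t → 0`. -/
def ModulusOfContinuity (ω : ℝ → ℝ) : Prop :=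
  Monotone ω ∧ (∀ t, 0 ≤ ω t) ∧ Tendsto ω (nhdsWithin 0 (Ioi 0)) (nhds 0)

/-- The Dini condition `∫₀¹ ω(t)/t dt < ∞`. -/
def DiniCondition (ω : ℝ → ℝ) : Prop :=
  IntegrableOn (fun t => ω t / t) (Ioc (0 : ℝ) 1) volume

/-- An `ω`-Calderón–Zygmund kernel. -/
structure CZKernel (d : ℕ) (ω : ℝ → ℝ) where
  kernel : Rd d → Rd d → ℝ
  CK : ℝ
  CK_pos : 0 < CK
  size : ∀ x y : Rd d, x ≠ y → |kernel x y| ≤ CK / dist x y ^ d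
  smooth : ∀ x x' y : Rd d, x ≠ y → dist x x' ≤ dist x y / 2 →
    |kernel x y - kernel x' y| + |kernel y x - kernel y x'| ≤
      1 / dist x y ^ d * ω (dist x x' / dist x y)

/-- Non-degeneracy of a Calderón–Zygmund kernel. -/
def CZKernel.NonDegenerate {d : ℕ} {ω : ℝ → ℝ} (K : CZKernel d ω) : Prop :=
  ∃ c : ℝ, 0 < c ∧ ∀ (x : Rd d) (r : ℝ), 0 < r →
    ∃ y : Rd d, c * r ≤ dist x y ∧ c / r ^ d ≤ |K.kernel y x|

/-- An `ω`-Calderón–Zygmund operator: a linear operator, bounded on some `L^{p₀}`, with an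
`ω`-Calderón–Zygmund kernel representation off the support. -/
structure CZOperator (d : ℕ) (ω : ℝ → ℝ) extends CZKernel d ω where
  T : (Rd d → ℝ) → Rd d → ℝ
  map_add : ∀ f g : Rd d → ℝ, T (f + g) = T f + T g
  map_smul : ∀ (c : ℝ) (f : Rd d → ℝ), T (c • f) = c • T f
  measurable_map : ∀ f : Rd d → ℝ, Measurable f → Measurable (T f)
  p₀ : ℝ
  one_lt_p₀ : 1 < p₀
  N₀ : ℝ
  bounded : ∀ f : Rd d → ℝ, Measurable f →
    wnorm p₀ (fun _ => 1) (T f) ≤ ENNReal.ofReal N₀ * wnorm p₀ (fun _ => 1) f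
  kernel_repr : ∀ f : Rd d → ℝ, BddCompactSupp f → ∀ x ∉ tsupport f,
    T f x = ∫ y, kernel x y * f y

/-- The commutator `[b, T] f = b · Tf − T(b f)`. -/
def commutatorOp (b : Rd d → ℝ) (T : (Rd d → ℝ) → Rd d → ℝ) : (Rd d → ℝ) → Rd d → ℝ :=
  fun f x => b x * T f x - T (fun y => b y * f y) x

/-- The sparse operator `𝒜^⋆_{S,b} f = Σ_{Q∈S} ⟨|b − ⟨b⟩_Q| |f|⟩_Q 1_Q`. -/
def sparseOpStar (S : Set (Cube d)) (b f : Rd d → ℝ) (x : Rd d) : ℝ≥0∞ :=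
  ∑' Q : S, (Q : Cube d).carrier.indicator
      (fun _ => ENNReal.ofReal (avg (Q : Cube d) fun y => |b y - avg (Q : Cube d) b| * |f y|)) x

/-- The sparse operator `f ↦ Σ_{Q∈S} ⟨|b − ⟨b⟩_Q|⟩_Q ⟨|f|⟩_Q 1_Q`. -/
def sparseOp2 (S : Set (Cube d)) (b f : Rd d → ℝ) (x : Rd d) : ℝ≥0∞ :=
  ∑' Q : S, (Q : Cube d).carrier.indicator
      (fun _ => ENNReal.ofReal ((avg (Q : Cube d) fun y => |b y - avg (Q : Cube d) b|) *
        avg (Q : Cube d) fun y => |f y|)) x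

/-- The sparse operator `f ↦ Σ_{Q∈S} (|Q|^{-s} ∫_Q |f|^s)^{1/s} 1_Q`. -/
def sparseOpPow (S : Set (Cube d)) (s : ℝ) (f : Rd d → ℝ) (x : Rd d) : ℝ≥0∞ :=
  ∑' Q : S, (Q : Cube d).carrier.indicator
      (fun _ => ENNReal.ofReal (((Q : Cube d).vol ^ (-s) *
        intC (Q : Cube d) fun y => |f y| ^ s) ^ (1 / s))) x


/-- For a laminar Carleson family, the total mass is controlled by the mass of the union. -/
theorem sum_measure_le_of_carleson {ι X : Type*} [MeasurableSpace X] (W V : Measure X)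
    (s : ι → Set X) (hs : ∀ i, MeasurableSet (s i)) (A : ℝ≥0∞) (F : Finset ι)
    (hlam : ∀ i ∈ F, ∀ j ∈ F, s i ⊆ s j ∨ s j ⊆ s i ∨ Disjoint (s i) (s j))
    (hcar : ∀ i ∈ F, ∀ G ⊆ F, (∀ j ∈ G, s j ⊆ s i) → ∑ j ∈ G, W (s j) ≤ A * W (s i))
    (hV : ∀ i ∈ F, W (s i) ≤ V (s i)) :
    ∑ i ∈ F, W (s i) ≤ A * V (⋃ i ∈ F, s i) := by
  classical
  induction F using Finset.strongInduction with
  | H F ih =>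
    rcases F.eq_empty_or_nonempty with rfl | hne
    · simp
    obtain ⟨i, hiF, hi⟩ := F.exists_maximalFor s hne
    have hsub : F.filter (fun j => ¬ s j ⊆ s i) ⊂ F :=
      Finset.filter_ssubset.2 ⟨i, hiF, by simp⟩
    have h2 := ih _ hsub (fun a ha b hb => hlam a (hsub.1 ha) b (hsub.1 hb))
      (fun a ha G hG => hcar a (hsub.1 ha) G (hG.trans hsub.1)) (fun a ha => hV a (hsub.1 ha))
    have h1 := hcar i hiF (F.filter (fun j => s j ⊆ s i)) (Finset.filter_subset _ _)
      (fun j hj => (Finset.mem_filter.1 hj).2)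
    have hdisj : Disjoint (s i) (⋃ j ∈ F.filter (fun j => ¬ s j ⊆ s i), s j) := by
      refine disjoint_iUnion₂_right.2 fun j hj => ?_
      obtain ⟨hjF, hj⟩ := Finset.mem_filter.1 hj
      rcases hlam i hiF j hjF with h | h | h
      · exact absurd (hi hjF h) hj
      · exact absurd h hj
      · exact h
    rw [← Finset.sum_filter_add_sum_filter_not F (fun j => s j ⊆ s i)]
    calc _ ≤ A * V (s i) + A * V (⋃ j ∈ F.filter (fun j => ¬ s j ⊆ s i), s j) :=
          add_le_add (h1.trans (mul_le_mul_right (hV i hiF) A)) h2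
      _ = A * V (s i ∪ ⋃ j ∈ F.filter (fun j => ¬ s j ⊆ s i), s j) := by
          rw [measure_union hdisj (Finset.measurableSet_biUnion _ fun j _ => hs j), mul_add]
      _ ≤ _ := by
          gcongr
          refine union_subset (subset_biUnion_of_mem (u := s) hiF) ?_
          exact biUnion_subset_biUnion_left fun j hj => hsub.1 hj

theorem sum_rpow_mul_eq_lintegral {ι : Type*} (F : Finset ι) (w : ι → ℝ≥0∞) (c : ι → ℝ)
    (hc : ∀ i, 0 ≤ c i) {p : ℝ} (hp : 0 < p) :
    ∑ i ∈ F, ENNReal.ofReal (c i ^ p) * w i =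
      ENNReal.ofReal p *
        ∫⁻ t in Ioi (0 : ℝ), (∑ i ∈ F with t < c i, w i) * ENNReal.ofReal (t ^ (p - 1)) := by
  classical
  let _ : MeasurableSpace ι := ⊤
  have h := lintegral_rpow_eq_lintegral_meas_lt_mul (∑ i ∈ F, w i • Measure.dirac i)
    (f := c) (Eventually.of_forall hc) (measurable_from_top).aemeasurable hp
  simp only [lintegral_finsetSum_measure, lintegral_smul_measure, smul_eq_mul,
    lintegral_dirac' _ (measurable_from_top), Measure.finsetSum_apply, Measure.smul_apply] at h
  convert! h using 2
  · simp [mul_comm]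
  · congr 1
    ext t
    congr 1
    rw [Finset.sum_filter]
    refine Finset.sum_congr rfl fun i _ => ?_
    rw [Measure.dirac_apply' _ MeasurableSpace.measurableSet_top]
    by_cases hi : t < c i <;> simp [hi]

/-- Carleson embedding for the coefficients of a maximal function. -/
theorem carleson_embedding_max {ι X : Type*} [MeasurableSpace X] (W : Measure X)
    (s : ι → Set X) (hs : ∀ i, MeasurableSet (s i)) (A : ℝ≥0∞) (F : Finset ι)
    (hlam : ∀ i ∈ F, ∀ j ∈ F, s i ⊆ s j ∨ s j ⊆ s i ∨ Disjoint (s i) (s j))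
    (hcar : ∀ i ∈ F, ∀ G ⊆ F, (∀ j ∈ G, s j ⊆ s i) → ∑ j ∈ G, W (s j) ≤ A * W (s i))
    (c : ι → ℝ) (hc : ∀ i, 0 ≤ c i) {p : ℝ} (hp : 0 < p) (g : X → ℝ≥0∞)
    (hg : ∀ i ∈ F, ∀ x ∈ s i, ENNReal.ofReal (c i) ≤ g x) :
    ∑ i ∈ F, ENNReal.ofReal (c i ^ p) * W (s i) ≤ A * ∫⁻ x, g x ^ p ∂W := by
  classical
  rcases F.eq_empty_or_nonempty with rfl | hne
  · simp
  set G : X → ℝ := fun x => F.sup' hne fun i => (s i).indicator (fun _ => c i) x with hG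
  have hG0 : ∀ x, 0 ≤ G x := fun x => by
    obtain ⟨i, hi⟩ := hne
    exact (Set.indicator_nonneg (fun _ _ => hc i) x).trans
      (Finset.le_sup' (fun i => (s i).indicator (fun _ => c i) x) hi)
  have hGm : Measurable G := by
    have := Finset.measurable_sup' hne
      (f := fun i x => (s i).indicator (fun _ => c i) x)
      fun i _ => measurable_const.indicator (hs i)
    convert this using 1
    ext x
    simp [hG, Finset.sup'_apply]
  have hGg : ∀ x, ENNReal.ofReal (G x) ≤ g x := fun x => by
    obtain ⟨i, hi, h⟩ := Finset.exists_mem_eq_sup' hne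
      fun i => (s i).indicator (fun _ => c i) x
    simp only [hG, h]
    by_cases hx : x ∈ s i
    · simpa [hx] using hg i hi x hx
    · simp [hx]
  calc _ ≤ ENNReal.ofReal p * ∫⁻ t in Ioi (0 : ℝ),
          A * (W {x | t < G x} * ENNReal.ofReal (t ^ (p - 1))) := by
        rw [sum_rpow_mul_eq_lintegral F _ c hc hp]
        refine mul_le_mul_right ?_ _
        refine setLIntegral_mono' measurableSet_Ioi fun t (ht : 0 < t) => ?_
        rw [← mul_assoc]
        gcongr
        have hF : F.filter (fun i => t < c i) ⊆ F := Finset.filter_subset _ _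
        refine (sum_measure_le_of_carleson W W s hs A _
          (fun a ha b hb => hlam a (hF ha) b (hF hb))
          (fun a ha G hG => hcar a (hF ha) G (hG.trans hF)) (fun a _ => le_rfl)).trans ?_
        gcongr
        refine iUnion₂_subset fun i hi x hx => ?_
        obtain ⟨hi, hti⟩ := Finset.mem_filter.1 hi
        refine lt_of_lt_of_le hti ?_
        have := Finset.le_sup' (fun i => (s i).indicator (fun _ => c i) x) hi
        simpa [hx] using this
    _ = A * ∫⁻ x, ENNReal.ofReal (G x ^ p) ∂W := by
        rw [lintegral_rpow_eq_lintegral_meas_lt_mul W (Eventually.of_forall hG0)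
          hGm.aemeasurable hp, lintegral_const_mul]
        · ring
        · refine Measurable.mul ?_ (by fun_prop)
          exact Antitone.measurable fun a b hab => measure_mono fun x (hx : b < G x) =>
            lt_of_le_of_lt hab hx
    _ ≤ _ := by
        gcongr with x
        rw [← ENNReal.ofReal_rpow_of_nonneg (hG0 x) hp.le]
        exact ENNReal.rpow_le_rpow (hGg x) hp.le

/-- The Carleson embedding theorem. -/
theorem carleson_embedding {ι X : Type*} [MeasurableSpace X] (W : Measure X)
    (s : ι → Set X) (hs : ∀ i, MeasurableSet (s i)) (A : ℝ≥0∞) (F : Finset ι)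
    (hlam : ∀ i ∈ F, ∀ j ∈ F, s i ⊆ s j ∨ s j ⊆ s i ∨ Disjoint (s i) (s j))
    (hcar : ∀ i ∈ F, ∀ G ⊆ F, (∀ j ∈ G, s j ⊆ s i) → ∑ j ∈ G, W (s j) ≤ A * W (s i))
    (hfin : ∀ i ∈ F, W (s i) ≠ ⊤)
    (c : ι → ℝ) (hc : ∀ i, 0 ≤ c i) {p : ℝ} (hp : 1 < p) (h : X → ℝ) (h0 : ∀ x, 0 ≤ h x)
    (hm : Measurable h)
    (hch : ∀ i ∈ F, ENNReal.ofReal (c i) * W (s i) ≤ ∫⁻ x in s i, ENNReal.ofReal (h x) ∂W) :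
    ∑ i ∈ F, ENNReal.ofReal (c i ^ p) * W (s i) ≤
      ENNReal.ofReal (2 ^ p * p / (p - 1)) * A * ∫⁻ x, ENNReal.ofReal (h x ^ p) ∂W := by
  classical
  set U : Measure X := W.withDensity fun x => ENNReal.ofReal (h x) with hU
  have hp1 : 0 < p - 1 := by linarith
  have hp0 : 0 < p := by linarith
  have key : ∀ t : ℝ, 0 < t → ∑ i ∈ F with t < c i, W (s i) ≤
      A * (ENNReal.ofReal (2 / t) * U {x | t < 2 * h x}) := by
    intro t ht
    have hF : F.filter (fun i => t < c i) ⊆ F := Finset.filter_subset _ _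
    have hmt : MeasurableSet {x | t < 2 * h x} := measurableSet_lt (by fun_prop) (by fun_prop)
    set V : Measure X := ENNReal.ofReal (2 / t) • U.restrict {x | t < 2 * h x} with hVdef
    refine (sum_measure_le_of_carleson W V s hs A _
      (fun a ha b hb => hlam a (hF ha) b (hF hb))
      (fun a ha G hG => hcar a (hF ha) G (hG.trans hF)) ?_).trans ?_
    · intro i hi
      obtain ⟨hi, hti⟩ := Finset.mem_filter.1 hi
      have e1 : ∫⁻ x in s i, ENNReal.ofReal (h x) ∂W ≤
          ENNReal.ofReal (t / 2) * W (s i) + U (s i ∩ {x | t < 2 * h x}) := by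
        rw [hU, withDensity_apply _ ((hs i).inter hmt)]
        rw [← lintegral_inter_add_sdiff _ (s i) hmt, add_comm]
        gcongr
        calc _ ≤ ∫⁻ x in s i \ {x | t < 2 * h x}, ENNReal.ofReal (t / 2) ∂W := by
              refine setLIntegral_mono' ((hs i).diff hmt) fun x hx => ?_
              have : ¬ t < 2 * h x := hx.2
              exact ENNReal.ofReal_le_ofReal (by linarith)
          _ ≤ _ := by
              rw [setLIntegral_const]
              gcongr
              exact sdiff_subset
      have e2 : ENNReal.ofReal t * W (s i) ≤
          ENNReal.ofReal (t / 2) * W (s i) + U (s i ∩ {x | t < 2 * h x}) :=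
        le_trans (by gcongr) ((hch i hi).trans e1)
      have e3 : ENNReal.ofReal t * W (s i) =
          ENNReal.ofReal (t / 2) * W (s i) + ENNReal.ofReal (t / 2) * W (s i) := by
        rw [← add_mul, ← ENNReal.ofReal_add (by positivity) (by positivity)]
        congr 2; ring
      rw [e3] at e2
      have e4 := (ENNReal.add_le_add_iff_left
        (ENNReal.mul_ne_top ENNReal.ofReal_ne_top (hfin i hi))).1 e2
      calc W (s i) = ENNReal.ofReal (2 / t) * (ENNReal.ofReal (t / 2) * W (s i)) := by
            rw [← mul_assoc, ← ENNReal.ofReal_mul (by positivity)]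
            have : 2 / t * (t / 2) = 1 := by field_simp
            simp [this]
        _ ≤ _ := by
            rw [hVdef, Measure.smul_apply, Measure.restrict_apply (hs i), smul_eq_mul]
            gcongr
    · gcongr
      rw [hVdef, Measure.smul_apply, smul_eq_mul]
      refine mul_le_mul_right ((measure_mono (subset_univ _)).trans ?_) _
      rw [Measure.restrict_apply_univ]
  have hUm : Measurable fun t : ℝ => U {x | t < 2 * h x} :=
    Antitone.measurable fun a b hab => measure_mono fun x (hx : b < 2 * h x) =>
      lt_of_le_of_lt hab hx
  calc _ ≤ ENNReal.ofReal p * ∫⁻ t in Ioi (0 : ℝ),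
          2 * A * (U {x | t < 2 * h x} * ENNReal.ofReal (t ^ (p - 1 - 1))) := by
        rw [sum_rpow_mul_eq_lintegral F _ c hc hp0]
        refine mul_le_mul_right ?_ _
        refine setLIntegral_mono' measurableSet_Ioi fun t (ht : 0 < t) => ?_
        refine (mul_le_mul_left (key t ht) _).trans (le_of_eq ?_)
        have : ENNReal.ofReal (2 / t) * ENNReal.ofReal (t ^ (p - 1)) =
            2 * ENNReal.ofReal (t ^ (p - 1 - 1)) := by
          rw [← ENNReal.ofReal_mul (by positivity), Real.rpow_sub_one ht.ne' (p - 1),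
            ← ENNReal.ofReal_ofNat 2, ← ENNReal.ofReal_mul (by positivity)]
          congr 1
          ring
        calc _ = A * U {x | t < 2 * h x} *
              (ENNReal.ofReal (2 / t) * ENNReal.ofReal (t ^ (p - 1))) := by ring
          _ = _ := by rw [this]; ring
    _ = 2 * A * (ENNReal.ofReal p * ∫⁻ t in Ioi (0 : ℝ),
          U {x | t < 2 * h x} * ENNReal.ofReal (t ^ (p - 1 - 1))) := by
        rw [lintegral_const_mul (2 * A) (f := fun t : ℝ => U {x | t < 2 * h x} *
          ENNReal.ofReal (t ^ (p - 1 - 1))) (hUm.mul (by fun_prop))]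
        ring
    _ = 2 * A * (ENNReal.ofReal (p / (p - 1)) *
          ∫⁻ x, ENNReal.ofReal ((2 * h x) ^ (p - 1)) ∂U) := by
        rw [lintegral_rpow_eq_lintegral_meas_lt_mul U
          (Eventually.of_forall fun x => mul_nonneg zero_le_two (h0 x))
          (by fun_prop) hp1, ← mul_assoc (ENNReal.ofReal (p / (p - 1))),
          ← ENNReal.ofReal_mul (by positivity), div_mul_cancel₀ _ hp1.ne']
    _ = 2 * A * (ENNReal.ofReal (p / (p - 1)) *
          ∫⁻ x, ENNReal.ofReal (2 ^ (p - 1)) * ENNReal.ofReal (h x ^ p) ∂W) := by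
        rw [hU, lintegral_withDensity_eq_lintegral_mul _ (by fun_prop) (by fun_prop)]
        congr 3
        ext x
        rw [Pi.mul_apply, ← ENNReal.ofReal_mul (h0 x), ← ENNReal.ofReal_mul (by positivity)]
        congr 1
        rw [Real.mul_rpow zero_le_two (h0 x)]
        rcases (h0 x).eq_or_lt with h | h
        · simp [← h, Real.zero_rpow hp0.ne']
        · rw [Real.rpow_sub_one h.ne' p]; field_simp
    _ = _ := by
        rw [lintegral_const_mul _ (by fun_prop)]
        have : ENNReal.ofReal (2 ^ p * p / (p - 1)) =
            2 * ENNReal.ofReal (p / (p - 1)) * ENNReal.ofReal (2 ^ (p - 1)) := by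
          rw [← ENNReal.ofReal_ofNat 2, ← ENNReal.ofReal_mul (by positivity),
            ← ENNReal.ofReal_mul (by positivity), Real.rpow_sub_one two_ne_zero p]
          congr 1
          field_simp
        rw [this]; ring

theorem Cube.vol_pos (Q : Cube d) : 0 < Q.vol := pow_pos Q.side_pos d

theorem Cube.carrier_eq (Q : Cube d) : Q.carrier = (WithLp.ofLp : Rd d → Fin d → ℝ) ⁻¹'
    (Set.univ.pi fun i => Ico (Q.corner i) (Q.corner i + Q.side)) := by
  ext x
  simp [Cube.carrier]

theorem Cube.measurableSet_carrier (Q : Cube d) : MeasurableSet Q.carrier := by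
  rw [Q.carrier_eq]
  exact (PiLp.volume_preserving_ofLp (Fin d)).measurable
    (MeasurableSet.univ_pi fun _ => measurableSet_Ico)

theorem Cube.volume_carrier (Q : Cube d) : volume Q.carrier = ENNReal.ofReal Q.vol := by
  rw [Q.carrier_eq, (PiLp.volume_preserving_ofLp (Fin d)).measure_preimage
    (MeasurableSet.univ_pi fun _ => measurableSet_Ico).nullMeasurableSet, Real.volume_pi_Ico]
  simp [Cube.vol, ENNReal.ofReal_pow Q.side_pos.le]

theorem Cube.isBounded_carrier (Q : Cube d) : Bornology.IsBounded Q.carrier := by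
  have h : IsCompact ((WithLp.toLp 2 : (Fin d → ℝ) → Rd d) ''
      (Set.univ.pi fun i => Icc (Q.corner i) (Q.corner i + Q.side))) :=
    (isCompact_univ_pi fun i => isCompact_Icc).image (PiLp.continuous_toLp 2 _)
  refine h.isBounded.subset fun x hx => ⟨WithLp.ofLp x, fun i _ => ⟨(hx i).1, (hx i).2.le⟩, rfl⟩

theorem Cube.integrableOn {f : Rd d → ℝ} (hf : LocallyIntegrable f volume) (Q : Cube d) :
    IntegrableOn f Q.carrier volume :=
  (hf.integrableOn_isCompact Q.isBounded_carrier.isCompact_closure).mono_set subset_closure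

/-- The measure `w dx`. -/
def weightMeasure (w : Rd d → ℝ) : Measure (Rd d) :=
  volume.withDensity fun x => ENNReal.ofReal (w x)

theorem weightMeasure_carrier {w : Rd d → ℝ} (hw : IsWeight w) (Q : Cube d) :
    weightMeasure w Q.carrier = ENNReal.ofReal (wInt Q w) := by
  rw [weightMeasure, withDensity_apply _ Q.measurableSet_carrier, wInt, intC,
    ofReal_integral_eq_lintegral_ofReal (Q.integrableOn hw.2.2)
      (Eventually.of_forall fun x => (hw.1 x).le)]

theorem IsWeight.wInt_pos {w : Rd d → ℝ} (hw : IsWeight w) (Q : Cube d) : 0 < wInt Q w := by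
  rw [wInt, intC, setIntegral_pos_iff_support_of_nonneg_ae
    (Eventually.of_forall fun x => (hw.1 x).le) (Q.integrableOn hw.2.2)]
  have : Function.support w = Set.univ := by
    ext x; simp [(hw.1 x).ne']
  rw [this, univ_inter, Q.volume_carrier]
  exact ENNReal.ofReal_pos.2 Q.vol_pos

theorem lintegral_weightMeasure {w : Rd d → ℝ} (hw : IsWeight w) (g : Rd d → ℝ≥0∞) :
    ∫⁻ x, g x ∂weightMeasure w = ∫⁻ x, g x * ENNReal.ofReal (w x) := by
  rw [weightMeasure, lintegral_withDensity_eq_lintegral_mul_non_measurable _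
    hw.2.1.ennreal_ofReal (Eventually.of_forall fun x => ENNReal.ofReal_lt_top)]
  simp [mul_comm]

theorem DyadicLattice.exists_superset (D : DyadicLattice d) (k : ℤ) (n : ℕ) :
    ∀ Q ∈ D.layer (k + n), ∃ R ∈ D.layer k, Q.carrier ⊆ R.carrier := by
  induction n with
  | zero => intro Q hQ; exact ⟨Q, by simpa using hQ, subset_rfl⟩
  | succ n ih =>
    intro Q hQ
    obtain ⟨R, hR, hQR⟩ := D.refines (k + n) Q (by
      have : k + ((n + 1 : ℕ) : ℤ) = k + n + 1 := by push_cast; ring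
      rwa [this] at hQ)
    obtain ⟨R', hR', hRR'⟩ := ih R hR
    exact ⟨R', hR', hQR.trans hRR'⟩

theorem DyadicLattice.nested (D : DyadicLattice d) {Q R : Cube d} (hQ : Q ∈ D.cubes)
    (hR : R ∈ D.cubes) : Q.carrier ⊆ R.carrier ∨ R.carrier ⊆ Q.carrier ∨
      Disjoint Q.carrier R.carrier := by
  have aux : ∀ (k : ℤ) (n : ℕ) (Q R : Cube d), Q ∈ D.layer (k + n) → R ∈ D.layer k →
      Q.carrier ⊆ R.carrier ∨ Disjoint Q.carrier R.carrier := by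
    intro k n Q R hQ hR
    obtain ⟨P, hP, hQP⟩ := D.exists_superset k n Q hQ
    by_cases h : P = R
    · exact Or.inl (h ▸ hQP)
    · exact Or.inr ((disjoint_iff_inter_eq_empty.2
        (D.pairwiseDisjoint k P hP R hR h)).mono_left hQP)
  obtain ⟨j, hj⟩ := hQ
  obtain ⟨k, hk⟩ := hR
  rcases le_total j k with h | h
  · obtain ⟨n, rfl⟩ := Int.le.dest h
    rcases aux j n R Q hk hj with h | h
    · exact Or.inr (Or.inl h)
    · exact Or.inr (Or.inr h.symm)
  · obtain ⟨n, rfl⟩ := Int.le.dest h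
    rcases aux k n Q R hj hk with h | h
    · exact Or.inl h
    · exact Or.inr (Or.inr h)

/-- The volume form of sparseness. -/
theorem SparseFamily.exists_volume {γ : ℝ} {S : Set (Cube d)}
    (hS : SparseFamily γ (fun _ => 1) S) :
    ∃ E : Cube d → Set (Rd d),
      (∀ Q ∈ S, E Q ⊆ Q.carrier ∧ MeasurableSet (E Q) ∧
        ENNReal.ofReal (γ * Q.vol) ≤ volume (E Q)) ∧
      S.Pairwise fun Q R => Disjoint (E Q) (E R) := by
  obtain ⟨E, hE, hd⟩ := hS
  refine ⟨E, fun Q hQ => ⟨(hE Q hQ).1, (hE Q hQ).2.1, ?_⟩, hd⟩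
  have h := (hE Q hQ).2.2
  have hne : volume (E Q) ≠ ⊤ := ne_top_of_le_ne_top
    (by rw [Q.volume_carrier]; exact ENNReal.ofReal_ne_top) (measure_mono (hE Q hQ).1)
  simp only [wInt, intC, setIntegral_const, smul_eq_mul, mul_one, measureReal_def,
    Q.volume_carrier, ENNReal.toReal_ofReal Q.vol_pos.le] at h
  exact ENNReal.ofReal_le_of_le_toReal h

theorem SparseFamily.countable {γ : ℝ} (hγ : 0 < γ) {S : Set (Cube d)}
    (hS : SparseFamily γ (fun _ => 1) S) : Countable S := by
  obtain ⟨E, hE, hd⟩ := hS.exists_volume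
  have h := Measure.countable_meas_pos_of_disjoint_iUnion (μ := (volume : Measure (Rd d)))
    (As := fun Q : S => E Q) (fun Q => (hE Q Q.2).2.1)
    (fun Q R hQR => hd Q.2 R.2 (Subtype.coe_injective.ne hQR))
  have : {Q : S | 0 < volume (E Q)} = Set.univ := by
    ext Q
    simpa using lt_of_lt_of_le (ENNReal.ofReal_pos.2 (mul_pos hγ Q.1.vol_pos)) (hE Q Q.2).2.2
  rw [this] at h
  exact countable_univ_iff.1 h

/-- Sparse families are Carleson with respect to `A_∞` weights. -/
theorem SparseFamily.carleson {γ : ℝ} (hγ : 0 < γ) {S : Set (Cube d)}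
    (hS : SparseFamily γ (fun _ => 1) S) {w : Rd d → ℝ} (hw : IsWeight w) (R : Cube d)
    (G : Finset (Cube d)) (hGS : ↑G ⊆ S) (hGR : ∀ Q ∈ G, Q.carrier ⊆ R.carrier) :
    ∑ Q ∈ G, weightMeasure w Q.carrier ≤
      ENNReal.ofReal γ⁻¹ * AinfCharOn Set.univ w * weightMeasure w R.carrier := by
  obtain ⟨E, hE, hd⟩ := hS.exists_volume
  set M : Rd d → ℝ≥0∞ := fun x => ⨆ (P : Cube d) (_ : P ∈ Set.univ) (_ : x ∈ P.carrier),
    ENNReal.ofReal ((∫ y in R.carrier ∩ P.carrier, w y) / P.vol) with hM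
  have hQ : ∀ Q ∈ G, weightMeasure w Q.carrier ≤
      ENNReal.ofReal γ⁻¹ * ∫⁻ x in E Q, M x := by
    intro Q hQ
    obtain ⟨hEQ, hEm, hvol⟩ := hE Q (hGS hQ)
    have h1 : ENNReal.ofReal (wInt Q w / Q.vol) * volume (E Q) ≤ ∫⁻ x in E Q, M x := by
      rw [← setLIntegral_const]
      refine setLIntegral_mono' hEm fun x hx => ?_
      refine le_trans (le_of_eq ?_) (le_iSup₂_of_le Q (mem_univ Q)
        (le_iSup_of_le (hEQ hx) le_rfl))
      rw [inter_eq_self_of_subset_right (hGR Q hQ)]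
      rfl
    have hwp := hw.wInt_pos Q
    have hvp := Q.vol_pos
    calc weightMeasure w Q.carrier
        = ENNReal.ofReal γ⁻¹ * (ENNReal.ofReal (wInt Q w / Q.vol) *
            ENNReal.ofReal (γ * Q.vol)) := by
          rw [weightMeasure_carrier hw, ← ENNReal.ofReal_mul (by positivity),
            ← ENNReal.ofReal_mul (by positivity)]
          congr 1
          field_simp
      _ ≤ _ := by
          refine mul_le_mul_right (le_trans ?_ h1) _
          gcongr
  have hR : ∫⁻ x in R.carrier, M x ≤ AinfCharOn Set.univ w * weightMeasure w R.carrier := by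
    have h : (∫⁻ x in R.carrier, M x) / ENNReal.ofReal (wInt R w) ≤ AinfCharOn Set.univ w :=
      le_iSup₂_of_le (f := fun (Q : Cube d) (_ : Q ∈ Set.univ) =>
        (∫⁻ x in Q.carrier,
          ⨆ (R : Cube d) (_ : R ∈ Set.univ) (_ : x ∈ R.carrier),
            ENNReal.ofReal ((∫ y in Q.carrier ∩ R.carrier, w y) / R.vol)) /
        ENNReal.ofReal (wInt Q w)) R (mem_univ R) le_rfl
    rw [weightMeasure_carrier hw]
    exact (ENNReal.div_le_iff (ENNReal.ofReal_pos.2 (hw.wInt_pos R)).ne'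
      ENNReal.ofReal_ne_top).1 h
  calc _ ≤ ∑ Q ∈ G, ENNReal.ofReal γ⁻¹ * ∫⁻ x in E Q, M x := Finset.sum_le_sum hQ
    _ = ENNReal.ofReal γ⁻¹ * ∫⁻ x in ⋃ Q ∈ G, E Q, M x := by
        rw [← Finset.mul_sum, lintegral_biUnion_finset (hd.mono hGS)
          fun Q hQ => (hE Q (hGS hQ)).2.1]
    _ ≤ ENNReal.ofReal γ⁻¹ * ∫⁻ x in R.carrier, M x := by
        gcongr
        exact iUnion₂_subset fun Q hQ => (hE Q (hGS hQ)).1.trans (hGR Q hQ)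
    _ ≤ _ := by
        rw [mul_assoc]
        gcongr

theorem sum_prod_rpow_le {ι κ : Type*} (F : Finset ι) (J : Finset κ) (f : κ → ι → ℝ≥0∞)
    {p : κ → ℝ} (hp : ∑ j ∈ J, p j = 1) (h0 : ∀ j ∈ J, 0 ≤ p j) :
    ∑ i ∈ F, ∏ j ∈ J, f j i ^ p j ≤ ∏ j ∈ J, (∑ i ∈ F, f j i) ^ p j := by
  let _ : MeasurableSpace ι := ⊤
  have h := ENNReal.lintegral_prod_norm_pow_le (μ := ∑ i ∈ F, Measure.dirac i) J (f := f)
    (fun _ _ => measurable_from_top.aemeasurable) hp h0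
  simpa only [lintegral_finsetSum_measure, lintegral_dirac' _ measurable_from_top] using h

theorem sum_rpow_mul_rpow_le {ι : Type*} (F : Finset ι) (x y : ι → ℝ≥0∞) {a b : ℝ}
    (ha : 0 ≤ a) (ha1 : a ≤ 1) (hab : 1 ≤ a + b) :
    ∑ i ∈ F, x i ^ a * y i ^ b ≤ (∑ i ∈ F, x i) ^ a * (∑ i ∈ F, y i) ^ b := by
  have hsplit : ∀ z : ℝ≥0∞, z ^ b = z ^ (1 - a) * z ^ (a + b - 1) := fun z => by
    rw [← ENNReal.rpow_add_of_nonneg _ _ (by linarith) (by linarith)]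
    congr 1
    ring
  have h := sum_prod_rpow_le F Finset.univ ![x, y] (p := ![a, 1 - a]) (by simp)
    (by intro j _; fin_cases j <;> simp <;> linarith)
  simp only [Fin.prod_univ_two, Matrix.cons_val_zero, Matrix.cons_val_one] at h
  calc _ ≤ ∑ i ∈ F, x i ^ a * y i ^ (1 - a) * (∑ i ∈ F, y i) ^ (a + b - 1) := by
        refine Finset.sum_le_sum fun i hi => ?_
        rw [hsplit, mul_assoc]
        gcongr
        exact Finset.single_le_sum (f := y) (fun _ _ => zero_le) hi
    _ ≤ _ := by
        rw [← Finset.sum_mul, hsplit (∑ i ∈ F, y i), ← mul_assoc]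
        gcongr

/-- Testing the `L^q` norm of a finite combination of indicators by duality. -/
theorem lq_norm_le_of_dual {ι X : Type*} [MeasurableSpace X] (L : Measure X)
    (s : ι → Set X) (hs : ∀ i, MeasurableSet (s i)) (F : Finset ι) (hfin : ∀ i ∈ F, L (s i) ≠ ⊤)
    (t : ι → ℝ) (ht : ∀ i, 0 ≤ t i) {q q' : ℝ} (hqq : q.HolderConjugate q') (M : ℝ≥0∞)
    (hM : ∀ k : X → ℝ, Measurable k → (∀ x, 0 ≤ k x) →
      (∀ i ∈ F, ∫⁻ x in s i, ENNReal.ofReal (k x) ∂L ≠ ⊤) →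
      ∑ i ∈ F, ENNReal.ofReal (t i) * ∫⁻ x in s i, ENNReal.ofReal (k x) ∂L ≤
        M * (∫⁻ x, ENNReal.ofReal (k x ^ q') ∂L) ^ (1 / q')) :
    (∫⁻ x, (∑ i ∈ F, (s i).indicator (fun _ => ENNReal.ofReal (t i)) x) ^ q ∂L) ^ (1 / q) ≤ M := by
  set G : X → ℝ := fun x => ∑ i ∈ F, (s i).indicator (fun _ => t i) x with hG
  have hq0 : 0 < q := hqq.pos
  have hq1 : 0 < q - 1 := by linarith [hqq.lt]
  have hG0 : ∀ x, 0 ≤ G x := fun x =>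
    Finset.sum_nonneg fun i _ => Set.indicator_nonneg (fun _ _ => ht i) x
  have hGm : Measurable G := Finset.measurable_sum _ fun i _ => measurable_const.indicator (hs i)
  have hGT : ∀ x, G x ≤ ∑ i ∈ F, t i := fun x =>
    Finset.sum_le_sum fun i _ => Set.indicator_le_self' (fun _ _ => ht i) x
  have hGE : ∀ x, ∑ i ∈ F, (s i).indicator (fun _ => ENNReal.ofReal (t i)) x =
      ENNReal.ofReal (G x) := fun x => by
    rw [hG, ENNReal.ofReal_sum_of_nonneg fun i _ => Set.indicator_nonneg (fun _ _ => ht i) x]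
    refine Finset.sum_congr rfl fun i _ => ?_
    by_cases hx : x ∈ s i <;> simp [hx]
  set I := ∫⁻ x, ENNReal.ofReal (G x ^ q) ∂L with hI
  have hkfin : ∀ i ∈ F, ∫⁻ x in s i, ENNReal.ofReal (G x ^ (q - 1)) ∂L ≠ ⊤ := fun i hi => by
    refine ne_top_of_le_ne_top (b := ENNReal.ofReal ((∑ i ∈ F, t i) ^ (q - 1)) * L (s i))
      (ENNReal.mul_ne_top ENNReal.ofReal_ne_top (hfin i hi)) ?_
    rw [← setLIntegral_const]
    refine lintegral_mono fun x => ENNReal.ofReal_le_ofReal ?_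
    exact Real.rpow_le_rpow (hG0 x) (hGT x) hq1.le
  have hIsum : I = ∑ i ∈ F, ENNReal.ofReal (t i) *
      ∫⁻ x in s i, ENNReal.ofReal (G x ^ (q - 1)) ∂L := by
    have hm : Measurable fun x => ENNReal.ofReal (G x ^ (q - 1)) := by fun_prop
    calc I = ∫⁻ x, ∑ i ∈ F, ENNReal.ofReal (t i) *
          (s i).indicator (fun x => ENNReal.ofReal (G x ^ (q - 1))) x ∂L := by
          refine lintegral_congr fun x => ?_
          have h1 : G x ^ q = G x * G x ^ (q - 1) := by
            rcases (hG0 x).eq_or_lt with h | h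
            · simp [← h, Real.zero_rpow hq0.ne']
            · rw [Real.rpow_sub_one h.ne']; field_simp
          rw [h1, ENNReal.ofReal_mul (hG0 x), ← hGE, Finset.sum_mul]
          refine Finset.sum_congr rfl fun i _ => ?_
          by_cases hx : x ∈ s i <;> simp [hx]
      _ = _ := by
          rw [lintegral_finsetSum _ fun i _ => (hm.indicator (hs i)).const_mul _]
          refine Finset.sum_congr rfl fun i _ => ?_
          rw [lintegral_const_mul _ (hm.indicator (hs i)), lintegral_indicator (hs i)]
  have hItop : I ≠ ⊤ := by
    rw [hIsum]
    exact ENNReal.sum_ne_top.2 fun i hi => ENNReal.mul_ne_top ENNReal.ofReal_ne_top (hkfin i hi)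
  have hmain := hM (fun x => G x ^ (q - 1)) (by fun_prop) (fun x => Real.rpow_nonneg (hG0 x) _) hkfin
  have hpow : ∀ x, (G x ^ (q - 1)) ^ q' = G x ^ q := fun x => by
    rw [← Real.rpow_mul (hG0 x), hqq.sub_one_mul_conj]
  simp only [hpow] at hmain
  rw [← hIsum, ← hI] at hmain
  have hLHS : ∫⁻ x, (∑ i ∈ F, (s i).indicator (fun _ => ENNReal.ofReal (t i)) x) ^ q ∂L = I := by
    refine lintegral_congr fun x => ?_
    rw [hGE, ENNReal.ofReal_rpow_of_nonneg (hG0 x) hq0.le]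
  rw [hLHS]
  rcases eq_or_ne I 0 with h0 | h0
  · rw [h0, ENNReal.zero_rpow_of_pos (by positivity)]
    exact zero_le
  have hne : I ^ (1 / q') ≠ 0 := by simp [ENNReal.rpow_eq_zero_iff, h0, hItop]
  have hnt : I ^ (1 / q') ≠ ⊤ :=
    ENNReal.rpow_ne_top_of_nonneg (one_div_nonneg.2 hqq.symm.nonneg) hItop
  have hfac : I = I ^ (1 / q) * I ^ (1 / q') := by
    rw [← ENNReal.rpow_add _ _ h0 hItop]
    have : 1 / q + 1 / q' = 1 := by simpa using hqq.inv_add_inv_eq_one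
    rw [this, ENNReal.rpow_one]
  rw [hfac, ← hfac] at hmain
  conv_lhs at hmain => rw [hfac]
  exact (ENNReal.mul_le_mul_iff_left hne hnt).1 hmain

theorem bloom_coefficient_identity {V S L N a b : ℝ} (hV : 0 < V) (hS : 0 < S) (hL : 0 < L)
    (hN : 0 < N) (o c e : ℝ) :
    V⁻¹ * o * (c * S / V) * (e * L) =
      ((V⁻¹ * S) ^ (1 - a) * (V⁻¹ * L) ^ (1 - b) * (V⁻¹ * N) ^ (a + b)) *
        (o / N ^ (a + b)) * (c * S ^ a) * (e * L ^ b) := by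
  have hSa := Real.rpow_pos_of_pos hS a
  have hLb := Real.rpow_pos_of_pos hL b
  have hVa := Real.rpow_pos_of_pos hV a
  have hVb := Real.rpow_pos_of_pos hV b
  have hNa := Real.rpow_pos_of_pos hN a
  have hNb := Real.rpow_pos_of_pos hN b
  rw [Real.mul_rpow (by positivity) hS.le, Real.mul_rpow (by positivity) hL.le,
    Real.mul_rpow (by positivity) hN.le, Real.inv_rpow hV.le, Real.inv_rpow hV.le,
    Real.inv_rpow hV.le, Real.rpow_sub hS, Real.rpow_sub hL, Real.rpow_sub hV, Real.rpow_sub hV,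
    Real.rpow_add hV, Real.rpow_add hN, Real.rpow_one, Real.rpow_one, Real.rpow_one]
  field_simp

theorem wnormE_sparseOp2_le {S : Set (Cube d)} [Countable S] {q : ℝ} (hq : 0 < q)
    {lam : Rd d → ℝ} (hlam : IsWeight lam) (b f : Rd d → ℝ) (M : ℝ≥0∞)
    (h : ∀ F : Finset (Cube d), ↑F ⊆ S →
      (∫⁻ x, (∑ Q ∈ F, Q.carrier.indicator (fun _ => ENNReal.ofReal
        ((avg Q fun y => |b y - avg Q b|) * avg Q fun y => |f y|)) x) ^ q
          ∂weightMeasure lam) ^ (1 / q) ≤ M) :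
    wnormE q lam (sparseOp2 S b f) ≤ M := by
  set u : Cube d → Rd d → ℝ≥0∞ := fun Q => Q.carrier.indicator (fun _ => ENNReal.ofReal
        ((avg Q fun y => |b y - avg Q b|) * avg Q fun y => |f y|)) with hu
  have hum : ∀ Q, Measurable (u Q) := fun Q =>
    measurable_const.indicator Q.measurableSet_carrier
  rw [wnormE, ← lintegral_weightMeasure hlam (fun x => sparseOp2 S b f x ^ q), one_div,
    ENNReal.rpow_inv_le_iff hq]
  have hsup : ∀ x, sparseOp2 S b f x ^ q = ⨆ F : Finset S, (∑ Q ∈ F, u Q x) ^ q := fun x => by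
    rw [sparseOp2, ENNReal.tsum_eq_iSup_sum]
    exact (ENNReal.orderIsoRpow q hq).map_iSup _
  simp only [hsup]
  rw [lintegral_iSup_directed fun F : Finset S =>
    ((Finset.measurable_sum F fun (Q : S) _ => hum Q).pow_const q).aemeasurable]
  · refine iSup_le fun F => ?_
    have hF := h (F.map (Function.Embedding.subtype _)) (by simp)
    rw [one_div, ENNReal.rpow_inv_le_iff hq] at hF
    simpa [hu] using hF
  · classical
    refine directed_of_isDirected_le fun F G hFG x => ?_
    refine ENNReal.rpow_le_rpow ?_ hq.le
    exact Finset.sum_le_sum_of_subset hFG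

theorem ofReal_setIntegral_abs_le {f : Rd d → ℝ} (hf : Measurable f) (s : Set (Rd d)) :
    ENNReal.ofReal (∫ x in s, |f x|) ≤ ∫⁻ x in s, ENNReal.ofReal |f x| := by
  rw [integral_eq_lintegral_of_nonneg_ae (Eventually.of_forall fun x => abs_nonneg _)
    (by fun_prop)]
  exact ENNReal.ofReal_toReal_le

theorem isWeight_dual {p : ℝ} {μ : Rd d → ℝ} (hμ : IsWeight μ)
    (h : LocallyIntegrable (fun x => μ x ^ (-(conj p / p))) volume) :
    IsWeight fun x => μ x ^ (-(conj p / p)) :=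
  ⟨fun x => Real.rpow_pos_of_pos (hμ.1 x) _, hμ.2.1.pow_const _, h⟩

theorem holderConjugate_conj {p : ℝ} (hp : 1 < p) : p.HolderConjugate (conj p) :=
  Real.HolderConjugate.conjExponent hp

/-- The `L^p(μ)` norm of `f` is the `L^p(σ)` norm of `f / σ`, where `σ` is the dual weight. -/
theorem lintegral_div_dual_rpow {p : ℝ} (hp : 1 < p) {μ : Rd d → ℝ} (hμ : IsWeight μ)
    (h : LocallyIntegrable (fun x => μ x ^ (-(conj p / p))) volume) (f : Rd d → ℝ) :
    (∫⁻ x, ENNReal.ofReal ((|f x| / μ x ^ (-(conj p / p))) ^ p)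
      ∂weightMeasure fun x => μ x ^ (-(conj p / p))) ^ (1 / p) = wnorm p μ f := by
  rw [wnorm, lintegral_weightMeasure (isWeight_dual hμ h)]
  congr 1
  refine lintegral_congr fun x => ?_
  have hx := hμ.1 x
  have hs := Real.rpow_pos_of_pos hx (-(conj p / p))
  rw [← ENNReal.ofReal_mul (by positivity), Real.div_rpow (abs_nonneg _) hs.le]
  congr 1
  have h1 : (μ x ^ (-(conj p / p))) ^ (1 - p) = μ x := by
    rw [← Real.rpow_mul hx.le]
    have : -(conj p / p) * (1 - p) = 1 := by
      have : p - 1 ≠ 0 := by linarith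
      rw [conj]; field_simp; ring
    rw [this, Real.rpow_one]
  conv_rhs => rw [← h1, Real.rpow_sub hs, Real.rpow_one]
  ring

theorem osc_nonneg (Q : Cube d) (b : Rd d → ℝ) : 0 ≤ osc Q b :=
  integral_nonneg fun _ => abs_nonneg _

/-- Testing the sparse operator: the bound is reduced to a bound on sums over cubes, in which
`x` and `y` are Carleson coefficients for the dual weight and for `λ`. -/
theorem sparse_norm_le {p q γ : ℝ} (hp : 1 < p) (hq : 1 < q) (hγ : 0 < γ)
    {μ lam ν : Rd d → ℝ} (hμ : IsWeight μ) (hlam : IsWeight lam) (hν : IsWeight ν)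
    (hσ : LocallyIntegrable (fun x => μ x ^ (-(conj p / p))) volume)
    (D : DyadicLattice d) {S : Set (Cube d)} (hSD : S ⊆ D.cubes)
    (hS : SparseFamily γ (fun _ => 1) S) (b : Rd d → ℝ) {f : Rd d → ℝ} (hf : Measurable f)
    (Z : ℝ≥0∞)
    (hZ : ∀ (F : Finset (Cube d)), ↑F ⊆ S → ∀ x y : Cube d → ℝ≥0∞,
      ∑ Q ∈ F, ENNReal.ofReal (osc Q b / wInt Q ν ^ (1 / p + 1 / conj q)) *
        (x Q ^ (1 / p) * y Q ^ (1 / conj q)) ≤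
      Z * ((∑ Q ∈ F, x Q) ^ (1 / p) * (∑ Q ∈ F, y Q) ^ (1 / conj q))) :
    wnormE q lam (sparseOp2 S b f) ≤
      BupperOn Set.univ p q (fun x => μ x ^ (-(conj p / p))) lam ν * Z *
        (ENNReal.ofReal (2 ^ p * p / (p - 1)) * (ENNReal.ofReal γ⁻¹ *
          AinfCharOn Set.univ (fun x => μ x ^ (-(conj p / p))))) ^ (1 / p) *
        (ENNReal.ofReal (2 ^ conj q * conj q / (conj q - 1)) * (ENNReal.ofReal γ⁻¹ *
          AinfCharOn Set.univ lam)) ^ (1 / conj q) * wnorm p μ f := by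
  have : Countable S := hS.countable hγ
  set σ : Rd d → ℝ := fun x => μ x ^ (-(conj p / p)) with hσdef
  have hσw : IsWeight σ := isWeight_dual hμ hσ
  have hqc := holderConjugate_conj hq
  have hpc := holderConjugate_conj hp
  have hcq1 : 1 < conj q := hqc.symm.lt
  have hcq0 : 0 < conj q := by linarith
  have hp0 : 0 < p := by linarith
  have htop : ∀ {w : Rd d → ℝ}, IsWeight w → ∀ Q : Cube d, weightMeasure w Q.carrier ≠ ⊤ :=
    fun hw Q => by rw [weightMeasure_carrier hw]; exact ENNReal.ofReal_ne_top
  refine wnormE_sparseOp2_le (by linarith) hlam b f _ fun F hF => ?_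
  have hnest : ∀ Q ∈ F, ∀ R ∈ F, Q.carrier ⊆ R.carrier ∨ R.carrier ⊆ Q.carrier ∨
      Disjoint Q.carrier R.carrier := fun Q hQ R hR => D.nested (hSD (hF hQ)) (hSD (hF hR))
  have hcarl : ∀ {w : Rd d → ℝ}, IsWeight w → ∀ R ∈ F, ∀ G ⊆ F,
      (∀ Q ∈ G, Q.carrier ⊆ R.carrier) → ∑ Q ∈ G, weightMeasure w Q.carrier ≤
        ENNReal.ofReal γ⁻¹ * AinfCharOn Set.univ w * weightMeasure w R.carrier :=
    fun hw R _ G hG h => hS.carleson hγ hw R G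
      ((Finset.coe_subset.2 hG).trans hF) h
  have havg : ∀ Q : Cube d, 0 ≤ avg Q fun y => |f y| := fun Q =>
    mul_nonneg (inv_nonneg.2 Q.vol_pos.le) (integral_nonneg fun _ => abs_nonneg _)
  have ht0 : ∀ Q : Cube d, 0 ≤ (avg Q fun y => |b y - avg Q b|) * avg Q fun y => |f y| :=
    fun Q => mul_nonneg (mul_nonneg (inv_nonneg.2 Q.vol_pos.le)
      (integral_nonneg fun _ => abs_nonneg _)) (havg Q)
  refine lq_norm_le_of_dual (weightMeasure lam) Cube.carrier Cube.measurableSet_carrier F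
    (fun Q _ => htop hlam Q) _ ht0 hqc _ fun k hkm hk0 hkfin => ?_
  set c : Cube d → ℝ := fun Q => (avg Q fun y => |f y|) * Q.vol / wInt Q σ with hc
  set e : Cube d → ℝ := fun Q =>
    (∫⁻ x in Q.carrier, ENNReal.ofReal (k x) ∂weightMeasure lam).toReal / wInt Q lam with he
  have hc0 : ∀ Q, 0 ≤ c Q := fun Q =>
    div_nonneg (mul_nonneg (havg Q) Q.vol_pos.le) (hσw.wInt_pos Q).le
  have he0 : ∀ Q, 0 ≤ e Q := fun Q => div_nonneg ENNReal.toReal_nonneg (hlam.wInt_pos Q).le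
  have heL : ∀ Q ∈ F, ∫⁻ x in Q.carrier, ENNReal.ofReal (k x) ∂weightMeasure lam =
      ENNReal.ofReal (e Q * wInt Q lam) := fun Q hQ => by
    rw [he, div_mul_cancel₀ _ (hlam.wInt_pos Q).ne', ENNReal.ofReal_toReal (hkfin Q hQ)]
  have hX := carleson_embedding (weightMeasure σ) Cube.carrier Cube.measurableSet_carrier
    _ F hnest (hcarl hσw) (fun Q _ => htop hσw Q) c hc0 hp (fun x => |f x| / σ x)
    (fun x => div_nonneg (abs_nonneg _) (hσw.1 x).le) (hf.abs.div hσw.2.1) fun Q _ => by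
      rw [weightMeasure_carrier hσw, ← ENNReal.ofReal_mul (hc0 Q), hc,
        div_mul_cancel₀ _ (hσw.wInt_pos Q).ne', avg, intC, mul_comm, ← mul_assoc,
        mul_inv_cancel₀ Q.vol_pos.ne', one_mul]
      refine (ofReal_setIntegral_abs_le hf _).trans (le_of_eq ?_)
      have hq : Measurable fun x => ENNReal.ofReal (|f x| / σ x) :=
        (hf.abs.div hσw.2.1).ennreal_ofReal
      rw [weightMeasure, setLIntegral_withDensity_eq_setLIntegral_mul _
        hσw.2.1.ennreal_ofReal hq Q.measurableSet_carrier]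
      refine lintegral_congr fun x => ?_
      rw [Pi.mul_apply, ← ENNReal.ofReal_mul (hσw.1 x).le, mul_div_cancel₀ _ (hσw.1 x).ne']
  have hY := carleson_embedding (weightMeasure lam) Cube.carrier Cube.measurableSet_carrier
    _ F hnest (hcarl hlam) (fun Q _ => htop hlam Q) e he0 hcq1 k hk0 hkm fun Q hQ => by
      rw [heL Q hQ, weightMeasure_carrier hlam, ENNReal.ofReal_mul (he0 Q)]
  set B := BupperOn Set.univ p q σ lam ν with hB
  have hroot : ∀ {w : Rd d → ℝ}, IsWeight w → ∀ {s : ℝ}, 0 < s → ∀ {u : ℝ}, 0 ≤ u →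
      ∀ Q : Cube d, (ENNReal.ofReal (u ^ s) * weightMeasure w Q.carrier) ^ (1 / s) =
        ENNReal.ofReal (u * wInt Q w ^ (1 / s)) := by
    intro w hw s hs u hu Q
    have hwp := hw.wInt_pos Q
    rw [weightMeasure_carrier hw, ← ENNReal.ofReal_mul (by positivity),
      ENNReal.ofReal_rpow_of_nonneg (by positivity) (by positivity),
      Real.mul_rpow (by positivity) hwp.le, ← Real.rpow_mul hu, mul_one_div_cancel hs.ne',
      Real.rpow_one]
  have hterm : ∀ Q ∈ F, ENNReal.ofReal ((avg Q fun y => |b y - avg Q b|) *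
        avg Q fun y => |f y|) *
        ∫⁻ x in Q.carrier, ENNReal.ofReal (k x) ∂weightMeasure lam ≤
      B * (ENNReal.ofReal (osc Q b / wInt Q ν ^ (1 / p + 1 / conj q)) *
        ((ENNReal.ofReal (c Q ^ p) * weightMeasure σ Q.carrier) ^ (1 / p) *
          (ENNReal.ofReal (e Q ^ conj q) * weightMeasure lam Q.carrier) ^ (1 / conj q))) := by
    intro Q hQ
    have hV := Q.vol_pos
    have hSp := hσw.wInt_pos Q
    have hLp := hlam.wInt_pos Q
    have hNp := hν.wInt_pos Q
    have ho := osc_nonneg Q b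
    have hcQ := hc0 Q
    have heQ := he0 Q
    have hBQ : ENNReal.ofReal (avg Q σ ^ (1 / conj p) * avg Q lam ^ (1 / q) *
        avg Q ν ^ (1 / p + 1 / conj q)) ≤ B :=
      le_iSup₂_of_le (f := fun (Q : Cube d) (_ : Q ∈ Set.univ) =>
        ENNReal.ofReal (avg Q σ ^ (1 / conj p) * avg Q lam ^ (1 / q) *
          avg Q ν ^ (1 / p + 1 / conj q))) Q (mem_univ Q) le_rfl
    have hp1 : 1 / conj p = 1 - 1 / p := by
      have := hpc.inv_add_inv_eq_one
      simp only [one_div]; linarith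
    have hq1 : 1 / q = 1 - 1 / conj q := by
      have := hqc.inv_add_inv_eq_one
      simp only [one_div]; linarith
    have hid := bloom_coefficient_identity (a := 1 / p) (b := 1 / conj q) hV hSp hLp hNp
      (osc Q b) (c Q) (e Q)
    have hcS : c Q * wInt Q σ / Q.vol = avg Q fun y => |f y| := by
      simp only [hc]; field_simp
    rw [hcS] at hid
    rw [heL Q hQ, ← ENNReal.ofReal_mul (ht0 Q), hroot hσw hp0 hcQ, hroot hlam hcq0 heQ]
    refine le_trans (le_of_eq ?_) (mul_le_mul_left hBQ _)
    rw [← ENNReal.ofReal_mul (by positivity), ← ENNReal.ofReal_mul (by positivity),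
      ← ENNReal.ofReal_mul (by
        simp only [avg]
        change 0 ≤ (Q.vol⁻¹ * wInt Q σ) ^ _ * (Q.vol⁻¹ * wInt Q lam) ^ _ *
          (Q.vol⁻¹ * wInt Q ν) ^ _
        positivity)]
    congr 1
    rw [hp1, hq1]
    refine hid.trans ?_
    simp only [avg, wInt]
    ring
  calc _ ≤ ∑ Q ∈ F, B * (ENNReal.ofReal (osc Q b / wInt Q ν ^ (1 / p + 1 / conj q)) *
        ((ENNReal.ofReal (c Q ^ p) * weightMeasure σ Q.carrier) ^ (1 / p) *
          (ENNReal.ofReal (e Q ^ conj q) * weightMeasure lam Q.carrier) ^ (1 / conj q))) :=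
        Finset.sum_le_sum hterm
    _ ≤ B * (Z * ((∑ Q ∈ F, ENNReal.ofReal (c Q ^ p) * weightMeasure σ Q.carrier) ^ (1 / p) *
          (∑ Q ∈ F, ENNReal.ofReal (e Q ^ conj q) * weightMeasure lam Q.carrier) ^
            (1 / conj q))) := by
        rw [← Finset.mul_sum]
        exact mul_le_mul_right (hZ F hF _ _) B
    _ ≤ B * (Z * ((ENNReal.ofReal (2 ^ p * p / (p - 1)) * (ENNReal.ofReal γ⁻¹ *
            AinfCharOn Set.univ σ) *
              ∫⁻ x, ENNReal.ofReal ((|f x| / σ x) ^ p) ∂weightMeasure σ) ^ (1 / p) *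
          (ENNReal.ofReal (2 ^ conj q * conj q / (conj q - 1)) * (ENNReal.ofReal γ⁻¹ *
            AinfCharOn Set.univ lam) *
              ∫⁻ x, ENNReal.ofReal (k x ^ conj q) ∂weightMeasure lam) ^ (1 / conj q))) := by
        gcongr
    _ = _ := by
        rw [ENNReal.mul_rpow_of_nonneg _ _ (by positivity : 0 ≤ 1 / p),
          ENNReal.mul_rpow_of_nonneg _ (∫⁻ x, ENNReal.ofReal (k x ^ conj q) ∂weightMeasure lam)
            (by positivity : 0 ≤ 1 / conj q), lintegral_div_dual_rpow hp hμ hσ f]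
        ring

theorem le_bmoNormOn (e : ℝ) (ν b : Rd d → ℝ) (Q : Cube d) :
    ENNReal.ofReal (osc Q b / wInt Q ν ^ e) ≤ bmoNormOn Set.univ e ν b :=
  le_iSup₂_of_le (f := fun (Q : Cube d) (_ : Q ∈ Set.univ) =>
    ENNReal.ofReal (osc Q b / wInt Q ν ^ e)) Q (mem_univ Q) le_rfl

/-- Carleson embedding for the weighted sharp maximal function. -/
theorem sum_osc_rpow_le {r γ : ℝ} (hr : 0 < r) (hγ : 0 < γ) {ν : Rd d → ℝ} (hν : IsWeight ν)
    (D : DyadicLattice d) {S : Set (Cube d)} (hSD : S ⊆ D.cubes)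
    (hS : SparseFamily γ (fun _ => 1) S) (b : Rd d → ℝ) (F : Finset (Cube d)) (hF : ↑F ⊆ S) :
    (∑ Q ∈ F, ENNReal.ofReal ((osc Q b / wInt Q ν) ^ r) * weightMeasure ν Q.carrier) ^ (1 / r) ≤
      (ENNReal.ofReal γ⁻¹ * AinfCharOn Set.univ ν) ^ (1 / r) * sharpNormOn Set.univ r ν b := by
  rw [sharpNormOn, wnormE, ← lintegral_weightMeasure hν (fun x => sharpMaxOn Set.univ ν b x ^ r),
    ← ENNReal.mul_rpow_of_nonneg _ _ (by positivity)]
  refine ENNReal.rpow_le_rpow ?_ (by positivity)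
  refine carleson_embedding_max (weightMeasure ν) Cube.carrier Cube.measurableSet_carrier _ F
    (fun Q hQ R hR => D.nested (hSD (hF hQ)) (hSD (hF hR)))
    (fun R _ G hG h => hS.carleson hγ hν R G ((Finset.coe_subset.2 hG).trans hF) h)
    (fun Q => osc Q b / wInt Q ν) (fun Q => div_nonneg (osc_nonneg Q b) (hν.wInt_pos Q).le) hr
    (sharpMaxOn Set.univ ν b) fun Q _ x hx => ?_
  exact le_iSup₂_of_le (f := fun (Q : Cube d) (_ : Q ∈ Set.univ) =>
    ⨆ _ : x ∈ Q.carrier, ENNReal.ofReal (osc Q b / wInt Q ν)) Q (mem_univ Q)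
    (le_iSup_of_le hx le_rfl)

/-- **Proposition 3.8**. Let `(μ',λ,ν) ∈ B_{p',q}` with `μ' = μ^{−p'/p}` and the Bloom
relation `ν^{1/p+1/q'} = μ^{1/p} λ^{−1/q}`. For any `γ`-sparse family `S` of dyadic cubes
and any `b ∈ L¹_loc`, the operator `f ↦ Σ_{Q∈S} ⟨|b−⟨b⟩_Q|⟩_Q ⟨|f|⟩_Q 1_Q` is bounded from
`L^p(μ)` to `L^q(λ)` with norm `≲ [μ',λ,ν]_{B_{p',q}} [μ']_{A_∞}^{1/p} [λ]_{A_∞}^{1/q'}`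
times `‖b‖_{BMO_ν^α}` if `p ≤ q`, respectively `[ν]_{A_∞}^{1/r} ‖M_ν^♯ b‖_{L^r(ν)}` if
`p > q`. -/
theorem stmt7 (d : ℕ) (hd : 0 < d) (p q r α γ : ℝ) (hp : 1 < p) (hq : 1 < q)
    (hr : 1 / r = 1 / q - 1 / p) (hα : α / d = 1 / p - 1 / q)
    (hγ : 0 < γ) (hγ1 : γ < 1) :
    ∃ C : ℝ, 0 < C ∧
      ∀ μ lam ν : Rd d → ℝ, IsWeight μ → IsWeight lam → IsWeight ν →
        LocallyIntegrable (fun x => μ x ^ (-(conj p / p))) volume →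
        (∀ x, ν x ^ (1 / p + 1 / conj q) = μ x ^ (1 / p) * lam x ^ (-(1 / q))) →
        BupperOn Set.univ p q (fun x => μ x ^ (-(conj p / p))) lam ν < ⊤ →
        ∀ (D : DyadicLattice d) (S : Set (Cube d)), S ⊆ D.cubes →
          SparseFamily γ (fun _ => 1) S →
          ∀ b : Rd d → ℝ, L1loc b →
            ∀ f : Rd d → ℝ, Measurable f →
              (p ≤ q →
                wnormE q lam (sparseOp2 S b f) ≤
                  ENNReal.ofReal C *
                    BupperOn Set.univ p q (fun x => μ x ^ (-(conj p / p))) lam ν *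
                    AinfCharOn Set.univ (fun x => μ x ^ (-(conj p / p))) ^ (1 / p) *
                    AinfCharOn Set.univ lam ^ (1 / conj q) *
                    bmoNormOn Set.univ (1 + α / d) ν b * wnorm p μ f) ∧
              (q < p →
                wnormE q lam (sparseOp2 S b f) ≤
                  ENNReal.ofReal C *
                    BupperOn Set.univ p q (fun x => μ x ^ (-(conj p / p))) lam ν *
                    AinfCharOn Set.univ (fun x => μ x ^ (-(conj p / p))) ^ (1 / p) *
                    AinfCharOn Set.univ lam ^ (1 / conj q) *
                    AinfCharOn Set.univ ν ^ (1 / r) *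
                    sharpNormOn Set.univ r ν b * wnorm p μ f) := by
  have hqc := holderConjugate_conj hq
  have hcq1 : 1 < conj q := hqc.symm.lt
  have hcq0 : 0 < conj q := by linarith
  have hp0 : 0 < p := by linarith
  have hp1 : 0 < p - 1 := by linarith
  have hq1 : 1 / q + 1 / conj q = 1 := by simpa using hqc.inv_add_inv_eq_one
  set K₁ : ℝ := (2 ^ p * p / (p - 1) * γ⁻¹) ^ (1 / p) with hK₁
  set K₂ : ℝ := (2 ^ conj q * conj q / (conj q - 1) * γ⁻¹) ^ (1 / conj q) with hK₂
  have hK₁0 : 0 < K₁ := by positivity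
  have hK₂0 : 0 < K₂ := by positivity
  refine ⟨K₁ * K₂ * max 1 (γ⁻¹ ^ (1 / r)), by positivity, ?_⟩
  intro μ lam ν hμ hlam hν hσ _ _ D S hSD hS b _ f hf
  have hconst : ∀ {s : ℝ}, 0 < s → ∀ {k : ℝ}, 0 ≤ k → ∀ A : ℝ≥0∞,
      (ENNReal.ofReal k * (ENNReal.ofReal γ⁻¹ * A)) ^ (1 / s) =
        ENNReal.ofReal ((k * γ⁻¹) ^ (1 / s)) * A ^ (1 / s) := by
    intro s hs k hk A
    rw [← mul_assoc, ← ENNReal.ofReal_mul hk, ENNReal.mul_rpow_of_nonneg _ _ (by positivity),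
      ENNReal.ofReal_rpow_of_nonneg (by positivity) (by positivity)]
  have hC : ENNReal.ofReal (K₁ * K₂ * max 1 (γ⁻¹ ^ (1 / r))) =
      ENNReal.ofReal K₁ * ENNReal.ofReal K₂ * ENNReal.ofReal (max 1 (γ⁻¹ ^ (1 / r))) := by
    rw [ENNReal.ofReal_mul (by positivity), ENNReal.ofReal_mul hK₁0.le]
  refine ⟨fun hpq => ?_, fun hqp => ?_⟩
  · have hexp : 1 / p + 1 / conj q = 1 + α / d := by rw [hα]; linarith
    have hge : 1 ≤ 1 / p + 1 / conj q := by
      have := one_div_le_one_div_of_le hp0 hpq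
      linarith
    refine (sparse_norm_le hp hq hγ hμ hlam hν hσ D hSD hS b hf
      (bmoNormOn Set.univ (1 + α / d) ν b) fun F hF x y => ?_).trans ?_
    · calc _ ≤ ∑ Q ∈ F, bmoNormOn Set.univ (1 + α / d) ν b *
            (x Q ^ (1 / p) * y Q ^ (1 / conj q)) := by
            refine Finset.sum_le_sum fun Q _ => mul_le_mul_left ?_ _
            rw [hexp]
            exact le_bmoNormOn _ ν b Q
        _ ≤ _ := by
            rw [← Finset.mul_sum]
            refine mul_le_mul_right (sum_rpow_mul_rpow_le F x y (by positivity) ?_ hge) _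
            exact (div_le_one hp0).2 hp.le
    · rw [hconst hp0 (by positivity), hconst hcq0 (by positivity), hC]
      have h1 : (1 : ℝ≥0∞) ≤ ENNReal.ofReal (max 1 (γ⁻¹ ^ (1 / r))) := by simp
      refine le_trans (le_of_eq ?_) (mul_le_mul_right h1 (ENNReal.ofReal K₁ * ENNReal.ofReal K₂ *
        BupperOn Set.univ p q (fun x => μ x ^ (-(conj p / p))) lam ν *
        AinfCharOn Set.univ (fun x => μ x ^ (-(conj p / p))) ^ (1 / p) *
        AinfCharOn Set.univ lam ^ (1 / conj q) *
        bmoNormOn Set.univ (1 + α / d) ν b * wnorm p μ f) |>.trans (le_of_eq ?_)) <;> ring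
  · have hr0 : 0 < r := by
      have := one_div_lt_one_div_of_lt (by linarith) hqp
      exact one_div_pos.1 (by linarith)
    have hsum : 1 / r + (1 / p + 1 / conj q) = 1 := by linarith
    refine (sparse_norm_le hp hq hγ hμ hlam hν hσ D hSD hS b hf
      ((ENNReal.ofReal γ⁻¹ * AinfCharOn Set.univ ν) ^ (1 / r) * sharpNormOn Set.univ r ν b)
      fun F hF x y => ?_).trans ?_
    · set z : Cube d → ℝ≥0∞ := fun Q =>
        ENNReal.ofReal ((osc Q b / wInt Q ν) ^ r) * weightMeasure ν Q.carrier with hz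
      have hzr : ∀ Q, ENNReal.ofReal (osc Q b / wInt Q ν ^ (1 / p + 1 / conj q)) =
          z Q ^ (1 / r) := fun Q => by
        have hN := hν.wInt_pos Q
        have ho := osc_nonneg Q b
        simp only [hz]
        rw [weightMeasure_carrier hν, ← ENNReal.ofReal_mul (by positivity),
          ENNReal.ofReal_rpow_of_nonneg (by positivity) (by positivity),
          Real.mul_rpow (by positivity) hN.le, ← Real.rpow_mul (by positivity),
          mul_one_div_cancel hr0.ne', Real.rpow_one,
          show 1 / p + 1 / conj q = 1 - 1 / r by linarith, Real.rpow_sub hN, Real.rpow_one]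
        congr 1
        field_simp
      have h := sum_prod_rpow_le F Finset.univ ![z, x, y] (p := ![1 / r, 1 / p, 1 / conj q])
        (by simpa [Fin.sum_univ_three, add_assoc] using hsum)
        (by
          intro j _
          fin_cases j
          · exact (one_div_pos.2 hr0).le
          · exact (one_div_pos.2 hp0).le
          · exact (one_div_pos.2 hcq0).le)
      simp only [Fin.prod_univ_three, Matrix.cons_val_zero, Matrix.cons_val_one,
        Matrix.cons_val, mul_assoc] at h
      simp only [hzr]
      exact h.trans (mul_le_mul_left (sum_osc_rpow_le hr0 hγ hν D hSD hS b F hF) _)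
    · rw [hconst hp0 (by positivity), hconst hcq0 (by positivity), hC,
        ENNReal.mul_rpow_of_nonneg _ _ (by positivity),
        ENNReal.ofReal_rpow_of_nonneg (by positivity) (by positivity)]
      have h1 : ENNReal.ofReal (γ⁻¹ ^ (1 / r)) ≤ ENNReal.ofReal (max 1 (γ⁻¹ ^ (1 / r))) :=
        ENNReal.ofReal_le_ofReal (le_max_right _ _)
      refine le_trans (le_of_eq ?_) (mul_le_mul_right h1 (ENNReal.ofReal K₁ * ENNReal.ofReal K₂ *
        BupperOn Set.univ p q (fun x => μ x ^ (-(conj p / p))) lam ν *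
        AinfCharOn Set.univ (fun x => μ x ^ (-(conj p / p))) ^ (1 / p) *
        AinfCharOn Set.univ lam ^ (1 / conj q) * AinfCharOn Set.univ ν ^ (1 / r) *
        sharpNormOn Set.univ r ν b * wnorm p μ f) |>.trans (le_of_eq ?_)) <;> ring
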